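/- Let L ⊆ A* be a factorial language and σ: A* → B* a substitution. If L is factor-balanced, then F(σ(L)) is factor-balanced. -/

import Mathlib

open List

/-- Number of occurrences of `v` as a factor of `w`, i.e. the number of
decompositions `w = p ++ v ++ s`. -/
def occ {A : Type*} [DecidableEq A] (v w : List A) : ℕ :=
  (List.range (w.length + 1)).countP (fun i => decide (v <+: w.drop i))

/-- Apply a substitution (given by its values on letters) to a word. -/
def applyS {A B : Type*} (σ : A → List B) (w : List A) : List B :=
  (w.map σ).flatten

section Occurrences

variable {A : Type*} [DecidableEq A]

theorem occ_nil_of_ne_nil {v : List A} (hv : v ≠ []) : occ v [] = 0 := by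
  simp [occ, List.range_succ, hv]

theorem occ_cons (v : List A) (a : A) (t : List A) :
    occ v (a :: t) = (if v <+: a :: t then 1 else 0) + occ v t := by
  unfold occ
  rw [List.length_cons, List.range_succ_eq_map, List.countP_cons, List.countP_map, add_comm]
  congr 1
  simp

theorem occ_le_length {v : List A} (hv : v ≠ []) (w : List A) : occ v w ≤ w.length := by
  induction w with
  | nil => simp [occ_nil_of_ne_nil hv]
  | cons a t ih =>
    rw [occ_cons, List.length_cons]
    split_ifs <;> omega

theorem occ_eq_zero_of_length_lt {v w : List A} (h : w.length < v.length) : occ v w = 0 := by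
  induction w with
  | nil => exact occ_nil_of_ne_nil (List.ne_nil_of_length_pos (by simpa using h))
  | cons a t ih =>
    rw [occ_cons, if_neg fun hp => absurd hp.length_le (by omega),
      ih (by rw [List.length_cons] at h; omega)]

theorem occ_append_le (v p s : List A) : occ v (p ++ s) ≤ p.length + occ v s := by
  induction p with
  | nil => simp
  | cons a t ih =>
    rw [List.cons_append, occ_cons, List.length_cons]
    split_ifs <;> omega

theorem occ_le_append_left (v p s : List A) : occ v s ≤ occ v (p ++ s) := by
  induction p with
  | nil => simp
  | cons a t ih =>
    rw [List.cons_append, occ_cons]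
    omega

theorem occ_concat {v : List A} (hv : v ≠ []) (w : List A) (b : A) :
    occ v w ≤ occ v (w ++ [b]) ∧ occ v (w ++ [b]) ≤ occ v w + 1 := by
  induction w with
  | nil =>
    rw [List.nil_append, occ_cons, occ_nil_of_ne_nil hv]
    split_ifs <;> omega
  | cons a t ih =>
    rw [List.cons_append, occ_cons, occ_cons]
    by_cases h1 : v <+: a :: t
    · rw [if_pos h1, if_pos (h1.trans ⟨[b], by simp⟩)]
      omega
    · rw [if_neg h1]
      by_cases h2 : v <+: a :: (t ++ [b])
      · rw [← List.cons_append, List.prefix_concat_iff] at h2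
        have h3 : v = a :: t ++ [b] := h2.resolve_right h1
        have h4 : occ v (t ++ [b]) = 0 := occ_eq_zero_of_length_lt (by simp [h3])
        rw [h4]
        split_ifs <;> omega
      · rw [if_neg h2]
        omega

theorem occ_append_right {v : List A} (hv : v ≠ []) (p s : List A) :
    occ v p ≤ occ v (p ++ s) ∧ occ v (p ++ s) ≤ occ v p + s.length := by
  induction s generalizing p with
  | nil => simp
  | cons b s ih =>
    have h1 := ih (p ++ [b])
    have h2 := occ_concat hv p b
    rw [List.append_assoc, List.singleton_append] at h1
    rw [List.length_cons]
    omega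

theorem occ_infix {v : List A} (hv : v ≠ []) (p w s : List A) :
    occ v w ≤ occ v (p ++ w ++ s) ∧
      occ v (p ++ w ++ s) ≤ occ v w + p.length + s.length := by
  have h1 := occ_append_right hv (p ++ w) s
  have h2 := occ_append_le v p w
  have h3 := occ_le_append_left v p w
  omega

/-- Number of occurrences of `v` in `p ++ s` that start inside `p`. -/
def occStart (v p s : List A) : ℕ :=
  occ v (p ++ s) - occ v s

theorem occ_append (v p s : List A) : occ v (p ++ s) = occStart v p s + occ v s := by
  have := occ_le_append_left v p s
  unfold occStart
  omega

theorem occStart_le (v p s : List A) : occStart v p s ≤ p.length := by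
  have := occ_append_le v p s
  unfold occStart
  omega

theorem occStart_cons (v : List A) (a : A) (p s : List A) :
    occStart v (a :: p) s = (if v <+: a :: (p ++ s) then 1 else 0) + occStart v p s := by
  have := occ_append v (a :: p) s
  have := occ_append v p s
  have := occ_cons v a (p ++ s)
  rw [List.cons_append] at *
  omega

theorem occStart_append_right {v s : List A} (h : v.length ≤ s.length) (p r : List A) :
    occStart v p (s ++ r) = occStart v p s := by
  induction p with
  | nil => simp [occStart]
  | cons a p ih =>
    have key : v <+: a :: (p ++ (s ++ r)) ↔ v <+: a :: (p ++ s) := by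
      have h1 : a :: (p ++ (s ++ r)) = a :: (p ++ s) ++ r := by simp
      rw [h1]
      refine ⟨fun h2 => List.prefix_of_prefix_length_le h2 (List.prefix_append _ _) ?_,
        fun h2 => h2.trans (List.prefix_append _ _)⟩
      simp only [List.length_cons, List.length_append]
      omega
    rw [occStart_cons, occStart_cons, ih]
    simp only [key]

end Occurrences

section Substitution

variable {A B : Type*} (σ : A → List B)

theorem applyS_cons (a : A) (t : List A) : applyS σ (a :: t) = σ a ++ applyS σ t := by
  simp [applyS]

theorem applyS_append (s t : List A) : applyS σ (s ++ t) = applyS σ s ++ applyS σ t := by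
  simp [applyS]

theorem length_applyS_le {M : ℕ} (hM : ∀ a, (σ a).length ≤ M) (y : List A) :
    (applyS σ y).length ≤ y.length * M := by
  induction y with
  | nil => simp [applyS]
  | cons a t ih =>
    rw [applyS_cons, List.length_append, List.length_cons, Nat.succ_mul]
    have := hM a
    omega

theorem length_applyS_eq_sum [Fintype A] [DecidableEq A] (y : List A) :
    (applyS σ y).length = ∑ a, occ [a] y * (σ a).length := by
  induction y with
  | nil => simp [applyS, occ_nil_of_ne_nil]
  | cons b t ih =>
    simp [applyS_cons, occ_cons, ih, add_mul, Finset.sum_add_distrib, ite_mul]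

theorem exists_suffix_applyS {M : ℕ} (hM : ∀ a, (σ a).length ≤ M) (y : List A) (p x : List B)
    (h : applyS σ y = p ++ x) :
    ∃ y', y' <:+ y ∧ ∃ p', applyS σ y' = p' ++ x ∧ p'.length ≤ M := by
  induction y generalizing p with
  | nil =>
    refine ⟨[], List.suffix_rfl, p, h, ?_⟩
    have := congrArg List.length h
    simp [applyS] at this
    omega
  | cons a t ih =>
    rw [applyS_cons] at h
    rcases List.append_eq_append_iff.1 h with ⟨q, hp, ht⟩ | ⟨q, hp, hx⟩
    · obtain ⟨y', hy', hp'⟩ := ih q ht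
      exact ⟨y', hy'.trans (List.suffix_cons _ _), hp'⟩
    · refine ⟨a :: t, List.suffix_rfl, p, by rw [applyS_cons, h], ?_⟩
      have h1 := hM a
      rw [hp, List.length_append] at h1
      omega

theorem exists_prefix_applyS {M : ℕ} (hM : ∀ a, (σ a).length ≤ M) (y : List A) (x s : List B)
    (h : applyS σ y = x ++ s) :
    ∃ y', y' <+: y ∧ ∃ s', applyS σ y' = x ++ s' ∧ s'.length ≤ M := by
  induction y generalizing x with
  | nil =>
    refine ⟨[], List.prefix_rfl, s, h, ?_⟩
    have := congrArg List.length h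
    simp [applyS] at this
    omega
  | cons a t ih =>
    rw [applyS_cons] at h
    rcases List.append_eq_append_iff.1 h with ⟨q, hx, ht⟩ | ⟨q, hp, hx⟩
    · obtain ⟨y', hy', s', hs', hl⟩ := ih q ht
      refine ⟨a :: y', List.cons_prefix_cons.2 ⟨rfl, hy'⟩, s', ?_, hl⟩
      rw [applyS_cons, hs', hx, List.append_assoc]
    · refine ⟨[a], List.cons_prefix_cons.2 ⟨rfl, List.nil_prefix⟩, q, by simp [applyS, hp], ?_⟩
      have h1 := hM a
      rw [hp, List.length_append] at h1
      omega

/-- A factor of `σ(y)` is, up to a bounded number of letters at both ends, the image of a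
factor of `y`. -/
theorem exists_infix_applyS {M : ℕ} (hM : ∀ a, (σ a).length ≤ M) {y : List A} {w : List B}
    (h : w <:+: applyS σ y) :
    ∃ y', y' <:+: y ∧ ∃ p s, applyS σ y' = p ++ w ++ s ∧ p.length ≤ M ∧ s.length ≤ M := by
  obtain ⟨p, s, h⟩ := h
  obtain ⟨y₁, hy₁, p', h₁, hp'⟩ :=
    exists_suffix_applyS σ hM y p (w ++ s) (by rw [← h, List.append_assoc])
  obtain ⟨y₂, hy₂, s', h₂, hs'⟩ :=
    exists_prefix_applyS σ hM y₁ (p' ++ w) s (by rw [h₁, List.append_assoc])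
  exact ⟨y₂, hy₂.isInfix.trans hy₁.isInfix, p', s', h₂, hp', hs'⟩

/-- If images of factors of length `N` are at least as long as `v`, then the occurrences of `v`
in `σ(y)` are counted, up to a boundary term, by the factors of `y` of length `N + 1`. -/
theorem occ_applyS_eq_sum [Fintype A] [DecidableEq A] [DecidableEq B] {N : ℕ} {v : List B}
    (y : List A)
    (hN : ∀ u : List A, u <:+: y → u.length = N → v.length ≤ (applyS σ u).length) :
    ∃ z : List A, z.length ≤ N ∧ occ v (applyS σ y) =
      ∑ u : Fin (N + 1) → A, occ (List.ofFn u) y *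
          occStart v (σ (u 0)) (applyS σ (List.ofFn fun i : Fin N => u i.succ)) +
        occ v (applyS σ z) := by
  induction y with
  | nil => exact ⟨[], by simp, by simp [occ_nil_of_ne_nil]⟩
  | cons a t ih =>
    by_cases hl : t.length < N
    · refine ⟨a :: t, by simpa using hl, ?_⟩
      rw [Finset.sum_eq_zero, zero_add]
      intro u _
      rw [occ_eq_zero_of_length_lt, zero_mul]
      simpa using hl
    · obtain ⟨z, hz, hzt⟩ := ih fun u hu => hN u (hu.trans (List.suffix_cons _ _).isInfix)
      refine ⟨z, hz, ?_⟩
      rw [applyS_cons, occ_append, hzt, ← add_assoc]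
      congr 1
      simp only [occ_cons, add_mul, Finset.sum_add_distrib]
      congr 1
      have htake : (t.take N).length = N := by
        rw [List.length_take]
        omega
      obtain ⟨f, hf⟩ : ∃ f : Fin N → A, List.ofFn f = t.take N :=
        ⟨fun i => (t.take N).get (i.cast htake.symm), by
          apply List.ext_getElem <;> simp [htake]⟩
      have hpre : ∀ u : Fin (N + 1) → A, List.ofFn u <+: a :: t ↔ u = Fin.cons a f := by
        intro u
        rw [List.ofFn_succ, List.cons_prefix_cons, List.prefix_iff_eq_take, List.length_ofFn,
          ← hf, List.ofFn_inj]
        constructor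
        · rintro ⟨h1, h2⟩
          rw [← h1, ← h2]
          exact (Fin.cons_self_tail u).symm
        · rintro rfl
          simp
      rw [Finset.sum_eq_single (Fin.cons a f)]
      · rw [if_pos ((hpre _).2 rfl), one_mul]
        simp only [Fin.cons_zero, Fin.cons_succ, hf]
        conv_lhs => rw [← List.take_append_drop N t, applyS_append]
        refine occStart_append_right (hN _ ?_ htake) _ _
        exact (List.take_prefix _ _).isInfix.trans (List.suffix_cons _ _).isInfix
      · intro u _ hu
        rw [if_neg fun h => hu ((hpre u).1 h), zero_mul]
      · simp

end Substitution

theorem abs_sum_mul_sub_sum_mul_le {ι : Type*} [Fintype ι] (f g c : ι → ℕ) {C M : ℕ}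
    (hfg : ∀ i, |(f i : ℤ) - (g i : ℤ)| ≤ C) (hc : ∀ i, c i ≤ M) :
    |((∑ i, f i * c i : ℕ) : ℤ) - ((∑ i, g i * c i : ℕ) : ℤ)| ≤
      ((Fintype.card ι * (C * M) : ℕ) : ℤ) := by
  push_cast
  rw [← Finset.sum_sub_distrib]
  refine (Finset.abs_sum_le_sum_abs _ _).trans ?_
  refine (Finset.sum_le_card_nsmul _ _ ((C : ℤ) * M) fun i _ => ?_).trans ?_
  · rw [← sub_mul, abs_mul, Nat.abs_cast]
    have := hc i
    have := hfg i
    gcongr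
  · simp

theorem exists_bound_length_applyS {A B : Type*} [Fintype A] [DecidableEq A]
    {L : Set (List A)} (σ : A → List B) {M : ℕ} (hM : ∀ a, (σ a).length ≤ M)
    (hbal : ∃ C : ℕ, ∀ v : List A, v.length = 1 →
      ∀ w ∈ L, ∀ w' ∈ L, w.length = w'.length → |(occ v w : ℤ) - (occ v w' : ℤ)| ≤ (C : ℤ)) :
    ∃ D : ℕ, ∀ y ∈ L, ∀ y' ∈ L, y.length = y'.length →
      |((applyS σ y).length : ℤ) - ((applyS σ y').length : ℤ)| ≤ (D : ℤ) := by
  obtain ⟨C, hC⟩ := hbal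
  refine ⟨Fintype.card A * (C * M), fun y hy y' hy' h => ?_⟩
  rw [length_applyS_eq_sum, length_applyS_eq_sum]
  exact abs_sum_mul_sub_sum_mul_le _ _ _ (fun a => hC [a] rfl y hy y' hy' h) hM

/-- Images of words of equal length in a factor-balanced language have almost the same number
of occurrences of a given word. -/
theorem exists_bound_occ_applyS {A B : Type*} [Fintype A] [DecidableEq A] [DecidableEq B]
    {L : Set (List A)} (σ : A → List B) {M : ℕ} (hM : ∀ a, (σ a).length ≤ M)
    (hfac : ∀ w ∈ L, ∀ v : List A, v <:+: w → v ∈ L)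
    (hbal : ∀ n : ℕ, 1 ≤ n → ∃ C : ℕ, ∀ v : List A, v.length = n →
      ∀ w ∈ L, ∀ w' ∈ L, w.length = w'.length →
        |(occ v w : ℤ) - (occ v w' : ℤ)| ≤ (C : ℤ)) (n : ℕ) (hn : 1 ≤ n) :
    ∃ K : ℕ, ∀ v : List B, v.length = n → ∀ y ∈ L, ∀ y' ∈ L, y.length = y'.length →
      |(occ v (applyS σ y) : ℤ) - (occ v (applyS σ y') : ℤ)| ≤ (K : ℤ) := by
  by_cases hN : ∃ N, ∀ u ∈ L, u.length = N → n ≤ (applyS σ u).length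
  · obtain ⟨N, hN⟩ := hN
    obtain ⟨C, hC⟩ := hbal (N + 1) (by omega)
    refine ⟨Fintype.card (Fin (N + 1) → A) * (C * M) + N * M, fun v hv y hy y' hy' h => ?_⟩
    have hv0 : v ≠ [] := List.ne_nil_of_length_pos (by omega)
    obtain ⟨z, hz, hyz⟩ := occ_applyS_eq_sum σ (N := N) (v := v) y
      fun u hu hl => hv ▸ hN u (hfac y hy u hu) hl
    obtain ⟨z', hz', hyz'⟩ := occ_applyS_eq_sum σ (N := N) (v := v) y'
      fun u hu hl => hv ▸ hN u (hfac y' hy' u hu) hl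
    have hsum := abs_sum_mul_sub_sum_mul_le
      (fun u : Fin (N + 1) → A => occ (List.ofFn u) y) (fun u => occ (List.ofFn u) y')
      (fun u => occStart v (σ (u 0)) (applyS σ (List.ofFn fun i : Fin N => u i.succ)))
      (fun u => hC (List.ofFn u) (by simp) y hy y' hy' h)
      (fun u => (occStart_le _ _ _).trans (hM _))
    have hb : ∀ x : List A, x.length ≤ N → occ v (applyS σ x) ≤ N * M := fun x hx =>
      (occ_le_length hv0 _).trans ((length_applyS_le σ hM x).trans (Nat.mul_le_mul_right M hx))
    have hbz := hb z hz
    have hbz' := hb z' hz'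
    rw [hyz, hyz']
    rw [abs_le] at hsum ⊢
    omega
  · push Not at hN
    obtain ⟨D, hD⟩ := exists_bound_length_applyS σ hM (hbal 1 le_rfl)
    refine ⟨n + D, fun v hv y hy y' hy' _ => ?_⟩
    have hv0 : v ≠ [] := List.ne_nil_of_length_pos (by omega)
    have hb : ∀ x ∈ L, occ v (applyS σ x) ≤ n + D := by
      intro x hx
      obtain ⟨u, hu, hul, hlt⟩ := hN x.length
      have h1 := abs_le.1 (hD x hx u hu hul.symm)
      have h2 := occ_le_length hv0 (applyS σ x)
      omega
    have h1 := hb y hy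
    have h2 := hb y' hy'
    rw [abs_le]
    omega

/-- if the factorial language `L` is factor-balanced, then the set of
factors of `σ(L)` is factor-balanced. -/
theorem factor_balanced_image {A B : Type*} [Fintype A] [DecidableEq A] [DecidableEq B]
    (L : Set (List A)) (σ : A → List B)
    (hfac : ∀ w ∈ L, ∀ v : List A, v <:+: w → v ∈ L)
    (hbal : ∀ n : ℕ, 1 ≤ n → ∃ C : ℕ, ∀ v : List A, v.length = n →
      ∀ w ∈ L, ∀ w' ∈ L, w.length = w'.length →
        |(occ v w : ℤ) - (occ v w' : ℤ)| ≤ (C : ℤ)) :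
    ∀ n : ℕ, 1 ≤ n → ∃ C : ℕ, ∀ v : List B, v.length = n →
      ∀ w ∈ {w : List B | ∃ y ∈ L, w <:+: applyS σ y},
        ∀ w' ∈ {w : List B | ∃ y ∈ L, w <:+: applyS σ y},
        w.length = w'.length → |(occ v w : ℤ) - (occ v w' : ℤ)| ≤ (C : ℤ) := by
  intro n hn
  obtain ⟨M, hM⟩ : ∃ M, ∀ a, (σ a).length ≤ M :=
    ⟨Finset.univ.sup fun a => (σ a).length,
      fun a => Finset.le_sup (f := fun a => (σ a).length) (Finset.mem_univ a)⟩
  obtain ⟨D, hD⟩ := exists_bound_length_applyS σ hM (hbal 1 le_rfl)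
  obtain ⟨K, hK⟩ := exists_bound_occ_applyS σ hM hfac hbal n hn
  refine ⟨4 * M + D + K, fun v hv => ?_⟩
  have hv0 : v ≠ [] := List.ne_nil_of_length_pos (by omega)
  have key : ∀ y ∈ L, ∀ y' ∈ L, y'.length ≤ y.length → ∀ p w s p' w' s' : List B,
      w.length = w'.length → applyS σ y = p ++ w ++ s → applyS σ y' = p' ++ w' ++ s' →
      p.length ≤ M → s.length ≤ M → p'.length ≤ M → s'.length ≤ M →
      |(occ v w : ℤ) - (occ v w' : ℤ)| ≤ ((4 * M + D + K : ℕ) : ℤ) := by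
    intro y hy y' hy' hle p w s p' w' s' hw h h' hp hs hp' hs'
    have hz : y.take y'.length ∈ L := hfac y hy _ (List.take_prefix _ _).isInfix
    have hzl : (y.take y'.length).length = y'.length := by
      rw [List.length_take]
      omega
    have h1 := abs_le.1 (hD _ hz y' hy' hzl)
    have h2 := abs_le.1 (hK v hv _ hz y' hy' hzl)
    have h3 := occ_append_right hv0 (applyS σ (y.take y'.length)) (applyS σ (y.drop y'.length))
    have h4 := congrArg List.length
      (applyS_append σ (y.take y'.length) (y.drop y'.length))
    rw [← applyS_append, List.take_append_drop] at h3
    rw [List.take_append_drop, List.length_append] at h4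
    have h5 := occ_infix hv0 p w s
    have h6 := occ_infix hv0 p' w' s'
    have h7 := congrArg List.length h
    have h8 := congrArg List.length h'
    simp only [List.length_append] at h7 h8
    rw [← h] at h5
    rw [← h'] at h6
    rw [abs_le]
    omega
  rintro w ⟨x, hx, hwx⟩ w' ⟨x', hx', hwx'⟩ hw
  obtain ⟨y, hy, p, s, h, hp, hs⟩ := exists_infix_applyS σ hM hwx
  obtain ⟨y', hy', p', s', h', hp', hs'⟩ := exists_infix_applyS σ hM hwx'
  have hyL := hfac x hx y hy
  have hyL' := hfac x' hx' y' hy'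
  rcases le_total y'.length y.length with hle | hle
  · exact key y hyL y' hyL' hle p w s p' w' s' hw h h' hp hs hp' hs'
  · rw [abs_sub_comm]
    exact key y' hyL' y hyL hle p' w' s' p w s hw.symm h' h hp' hs' hp hs
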